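/- For c in the open unit disc 𝔻 ⊂ ℂ let φ_c : 𝔻 → 𝔻 be the disc automorphism φ_c(z) = (z − c)/(1 − c̄·z), and for θ ∈ ℝ let R_{c,θ} = φ_c⁻¹ ∘ (z ↦ e^{2πiθ}z) ∘ φ_c be the rotation of 𝔻 with centre c and angle 2πθ. Let γ = R_{c₁,θ₁} and τ = R_{c₂,θ₂} where θ₁ and θ₂ are irrational real numbers. Then either c₁ = c₂, in which case the semigroup ⟨γ, τ⟩ generated by γ and τ under composition is abelian, or c₁ ≠ c₂ and ⟨γ, τ⟩ contains a non-cyclic free subsemigroup. -/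

import Mathlib

open Function

noncomputable section

/-- The disc automorphism `φ_c (z) = (z - c) / (1 - ̄c z)`. -/
def discMobius (c : ℂ) : ℂ → ℂ :=
  fun z => (z - c) / (1 - (starRingEnd ℂ) c * z)

/-- The inverse disc automorphism `φ_c⁻¹ (w) = (w + c) / (1 + ̄c w)`. -/
def discMobiusInv (c : ℂ) : ℂ → ℂ :=
  fun w => (w + c) / (1 + (starRingEnd ℂ) c * w)

/-- The rotation of the unit disc with centre `c` and angle `2πθ` :
`R_{c,θ} = φ_c⁻¹ ∘ (z ↦ e^{2πiθ} z) ∘ φ_c`. -/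
def discRotation (c : ℂ) (θ : ℝ) : ℂ → ℂ :=
  fun z => discMobiusInv c (Complex.exp (2 * (Real.pi : ℂ) * Complex.I * (θ : ℂ)) * discMobius c z)

section DiscAut

open Metric Set ComplexConjugate

/-- `f` agrees on the unit disc with a Möbius automorphism of the disc. -/
def IsDiscAut (f : ℂ → ℂ) : Prop :=
  ∃ α β : ℂ, ‖β‖ < ‖α‖ ∧ ∀ z ∈ ball (0 : ℂ) 1, f z = (α * z + β) / (conj β * z + conj α)

lemma disc_denom_ne_zero {α β z : ℂ} (h : ‖β‖ < ‖α‖) (hz : ‖z‖ ≤ 1) :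
    conj β * z + conj α ≠ 0 := by
  intro h0
  have h1 : conj α = -(conj β * z) := by linear_combination h0
  have h2 : ‖α‖ = ‖β‖ * ‖z‖ := by
    rw [← RCLike.norm_conj α, h1, norm_neg, norm_mul, RCLike.norm_conj]
  nlinarith [norm_nonneg β]

lemma disc_norm_identity (α β z : ℂ) :
    ‖conj β * z + conj α‖ ^ 2 - ‖α * z + β‖ ^ 2 =
      (‖α‖ ^ 2 - ‖β‖ ^ 2) * (1 - ‖z‖ ^ 2) := by
  simp only [← Complex.normSq_eq_norm_sq, Complex.normSq_apply, Complex.add_re, Complex.add_im,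
    Complex.mul_re, Complex.mul_im, Complex.conj_re, Complex.conj_im]
  ring

lemma disc_mobius_norm_lt_one {α β z : ℂ} (h : ‖β‖ < ‖α‖) (hz : ‖z‖ < 1) :
    ‖(α * z + β) / (conj β * z + conj α)‖ < 1 := by
  have hd := norm_pos_iff.mpr (disc_denom_ne_zero h hz.le)
  rw [norm_div, div_lt_one hd]
  have h1 := disc_norm_identity α β z
  have h2 : 0 < (‖α‖ ^ 2 - ‖β‖ ^ 2) * (1 - ‖z‖ ^ 2) := by
    apply mul_pos <;> nlinarith [norm_nonneg β, norm_nonneg z]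
  exact lt_of_pow_lt_pow_left₀ 2 hd.le (by linarith)

namespace IsDiscAut

lemma mapsTo {f : ℂ → ℂ} (hf : IsDiscAut f) : MapsTo f (ball 0 1) (ball 0 1) := by
  obtain ⟨α, β, h, hf⟩ := hf
  intro z hz
  rw [hf z hz, mem_ball_zero_iff]
  exact disc_mobius_norm_lt_one h (mem_ball_zero_iff.mp hz)

lemma injOn {f : ℂ → ℂ} (hf : IsDiscAut f) : InjOn f (ball 0 1) := by
  obtain ⟨α, β, h, hf⟩ := hf
  intro z hz w hw hzw
  rw [hf z hz, hf w hw, div_eq_div_iff (disc_denom_ne_zero h (mem_ball_zero_iff.mp hz).le)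
    (disc_denom_ne_zero h (mem_ball_zero_iff.mp hw).le)] at hzw
  have h1 : (α * conj α - β * conj β) * (z - w) = 0 := by linear_combination hzw
  rcases mul_eq_zero.mp h1 with h2 | h2
  · rw [Complex.mul_conj', Complex.mul_conj', sub_eq_zero] at h2
    norm_cast at h2
    nlinarith [norm_nonneg β]
  · exact sub_eq_zero.mp h2

lemma comp {f g : ℂ → ℂ} (hf : IsDiscAut f) (hg : IsDiscAut g) : IsDiscAut (f ∘ g) := by
  have hm := hg.mapsTo
  obtain ⟨α, β, h, hf⟩ := hf
  obtain ⟨α', β', h', hg⟩ := hg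
  refine ⟨α * α' + β * conj β', α * β' + β * conj α', ?_, fun z hz => ?_⟩
  · have key : ‖α * α' + β * conj β'‖ ^ 2 - ‖α * β' + β * conj α'‖ ^ 2 =
        (‖α‖ ^ 2 - ‖β‖ ^ 2) * (‖α'‖ ^ 2 - ‖β'‖ ^ 2) := by
      simp only [← Complex.normSq_eq_norm_sq, Complex.normSq_apply, Complex.add_re,
        Complex.add_im, Complex.mul_re, Complex.mul_im, Complex.conj_re, Complex.conj_im]
      ring
    have h2 : 0 < (‖α‖ ^ 2 - ‖β‖ ^ 2) * (‖α'‖ ^ 2 - ‖β'‖ ^ 2) := by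
      apply mul_pos <;> nlinarith [norm_nonneg β, norm_nonneg β']
    exact lt_of_pow_lt_pow_left₀ 2 (norm_nonneg _) (by linarith)
  · have hz1 := (mem_ball_zero_iff.mp hz).le
    have hgz := hm hz
    have hd := disc_denom_ne_zero h' hz1
    rw [Function.comp_apply, hf _ hgz, hg z hz]
    have e1 : α * ((α' * z + β') / (conj β' * z + conj α')) + β =
        ((α * α' + β * conj β') * z + (α * β' + β * conj α')) / (conj β' * z + conj α') := by
      rw [eq_div_iff hd, add_mul, mul_assoc, div_mul_cancel₀ _ hd]; ring
    have e2 : conj β * ((α' * z + β') / (conj β' * z + conj α')) + conj α =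
        (conj (α * β' + β * conj α') * z + conj (α * α' + β * conj β')) /
          (conj β' * z + conj α') := by
      simp only [map_add, map_mul, Complex.conj_conj]
      rw [eq_div_iff hd, add_mul, mul_assoc, div_mul_cancel₀ _ hd]; ring
    rw [e1, e2, div_div_div_cancel_right₀ hd]

lemma continuousAt {f : ℂ → ℂ} (hf : IsDiscAut f) {z : ℂ} (hz : z ∈ ball (0 : ℂ) 1) :
    ContinuousAt f z := by
  obtain ⟨α, β, h, hf⟩ := hf
  have h1 : ContinuousAt (fun z => (α * z + β) / (conj β * z + conj α)) z :=
    ContinuousAt.div (by fun_prop) (by fun_prop)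
      (disc_denom_ne_zero h (mem_ball_zero_iff.mp hz).le)
  refine h1.congr ?_
  filter_upwards [isOpen_ball.mem_nhds hz] with w hw using (hf w hw).symm

end IsDiscAut

lemma isDiscAut_discMobius {c : ℂ} (hc : ‖c‖ < 1) : IsDiscAut (discMobius c) :=
  ⟨1, -c, by simpa using hc, fun z _ => by simp [discMobius]; ring⟩

lemma isDiscAut_discMobiusInv {c : ℂ} (hc : ‖c‖ < 1) : IsDiscAut (discMobiusInv c) :=
  ⟨1, c, by simpa using hc, fun z _ => by simp [discMobiusInv]; ring⟩

lemma isDiscAut_mul_left {u : ℂ} (hu : ‖u‖ = 1) : IsDiscAut (fun z => u * z) := by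
  obtain ⟨v, hv⟩ : ∃ v : ℂ, v ^ 2 = u := IsAlgClosed.exists_pow_nat_eq u two_pos
  have hv1 : ‖v‖ = 1 := by
    rw [← hv, norm_pow] at hu
    exact (pow_eq_one_iff_of_nonneg (norm_nonneg v) two_ne_zero).mp hu
  have hvv : v * conj v = 1 := by rw [Complex.mul_conj', hv1]; simp
  refine ⟨v, 0, by simp [hv1], fun z _ => ?_⟩
  have hv0 : conj v ≠ 0 := right_ne_zero_of_mul_eq_one hvv
  simp only [map_zero, zero_mul, zero_add, add_zero]
  rw [eq_div_iff hv0, ← hv]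
  linear_combination v * z * hvv

lemma norm_exp_two_pi_I_mul (θ : ℝ) :
    ‖Complex.exp (2 * (Real.pi : ℂ) * Complex.I * (θ : ℂ))‖ = 1 := by
  rw [Complex.norm_exp]; simp

lemma isDiscAut_discRotation {c : ℂ} (hc : ‖c‖ < 1) (θ : ℝ) : IsDiscAut (discRotation c θ) :=
  (isDiscAut_discMobiusInv hc).comp
    ((isDiscAut_mul_left (norm_exp_two_pi_I_mul θ)).comp (isDiscAut_discMobius hc))

lemma one_sub_conj_mul_self_ne_zero {c : ℂ} (hc : ‖c‖ < 1) : 1 - conj c * c ≠ 0 := by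
  rw [Complex.conj_mul', sub_ne_zero]
  norm_cast
  nlinarith [norm_nonneg c]

lemma discMobiusInv_discMobius {c z : ℂ} (hc : ‖c‖ < 1) (hz : z ∈ ball (0 : ℂ) 1) :
    discMobiusInv c (discMobius c z) = z := by
  have hd : 1 - conj c * z ≠ 0 := by
    have := disc_denom_ne_zero (α := 1) (β := -c) (by simpa using hc)
      (mem_ball_zero_iff.mp hz).le
    simpa [sub_eq_neg_add] using this
  have hn := one_sub_conj_mul_self_ne_zero hc
  have e1 : (z - c) / (1 - conj c * z) + c = z * (1 - conj c * c) / (1 - conj c * z) := by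
    rw [eq_div_iff hd, add_mul, div_mul_cancel₀ _ hd]; ring
  have e2 : 1 + conj c * ((z - c) / (1 - conj c * z)) = (1 - conj c * c) / (1 - conj c * z) := by
    rw [eq_div_iff hd, add_mul, mul_assoc, div_mul_cancel₀ _ hd]; ring
  rw [discMobiusInv, discMobius, e1, e2, div_div_div_cancel_right₀ hd, mul_div_cancel_right₀ _ hn]

lemma discMobius_discMobiusInv {c z : ℂ} (hc : ‖c‖ < 1) (hz : z ∈ ball (0 : ℂ) 1) :
    discMobius c (discMobiusInv c z) = z :=
  (isDiscAut_discMobiusInv hc).injOn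
    ((isDiscAut_discMobius hc).mapsTo ((isDiscAut_discMobiusInv hc).mapsTo hz)) hz
    (discMobiusInv_discMobius hc ((isDiscAut_discMobiusInv hc).mapsTo hz))

lemma exists_pow_exp_near {θ : ℝ} (hθ : Irrational θ) {w : ℂ} (hw : ‖w‖ = 1) {ε : ℝ}
    (hε : 0 < ε) :
    ∃ n : ℕ, ‖Complex.exp (2 * (Real.pi : ℂ) * Complex.I * (θ : ℂ)) ^ n - w‖ < ε := by
  have : Fact ((0 : ℝ) < 1) := ⟨one_pos⟩
  have h1 : DenseRange (fun n : ℕ => n • (θ : AddCircle (1 : ℝ))) := by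
    rw [← denseRange_zsmul_iff_nsmul, AddCircle.denseRange_zsmul_coe_iff]
    simpa using hθ
  have hs : Function.Surjective (AddCircle.toCircle (T := 1)) := fun x => by
    obtain ⟨y, rfl⟩ := (AddCircle.homeomorphCircle (T := 1) one_ne_zero).surjective x
    exact ⟨y, (AddCircle.homeomorphCircle_apply one_ne_zero y).symm⟩
  have h2 := hs.denseRange.comp h1 AddCircle.continuous_toCircle
  obtain ⟨n, hn⟩ := h2.exists_dist_lt ⟨w, show w ∈ sphere (0 : ℂ) 1 by simpa using hw⟩ hε
  refine ⟨n, ?_⟩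
  have hn' := dist_comm _ _ |>.trans_lt hn
  refine lt_of_eq_of_lt ?_ (show dist (_ : ℂ) w < ε from hn')
  rw [Complex.dist_eq]
  congr 2
  simp only [Function.comp_apply, AddCircle.toCircle_nsmul, AddCircle.toCircle_apply_mk]
  rw [Circle.coe_pow, Circle.coe_exp]
  congr 2
  push_cast
  ring


section RotationAndTransvection

variable {S : Subsemigroup (Function.End ℂ)} {θ : ℝ} {g τ : Function.End ℂ}

lemma exists_mem_eqOn_pow_mul {u : ℂ} (hS : ∀ f ∈ S, IsDiscAut f) (hg : g ∈ S)
    (hgu : ∀ z ∈ ball (0 : ℂ) 1, g z = u * z) {f : Function.End ℂ} (hf : f ∈ S) (n : ℕ) :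
    ∃ f' ∈ S, ∀ z ∈ ball (0 : ℂ) 1, f' z = u ^ n * f z := by
  induction n with
  | zero => exact ⟨f, hf, fun z _ => by simp⟩
  | succ n ih =>
    obtain ⟨f', hf', h⟩ := ih
    refine ⟨g * f', S.mul_mem hg hf', fun z hz => ?_⟩
    change g (f' z) = _
    rw [hgu _ ((hS f' hf').mapsTo hz), h z hz, pow_succ']
    ring

/-- If all elements of `S` are disc automorphisms, and `S` contains an irrational rotation about
`0` and a map which does not fix `0`, then the orbit of `0` accumulates at the unit circle. -/
lemma exists_mem_lt_norm_apply_zero (hS : ∀ f ∈ S, IsDiscAut f) (hθ : Irrational θ) (hg : g ∈ S)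
    (hgu : ∀ z ∈ ball (0 : ℂ) 1,
      g z = Complex.exp (2 * (Real.pi : ℂ) * Complex.I * (θ : ℂ)) * z)
    (hτ : τ ∈ S) (hτ0 : τ 0 ≠ 0) {R : ℝ} (hR : R < 1) : ∃ f ∈ S, R < ‖f 0‖ := by
  have h0 : (0 : ℂ) ∈ ball (0 : ℂ) 1 := by simp
  set O : Set ℂ := {w | ∃ f ∈ S, f 0 = w}
  have hOb : O ⊆ ball 0 1 := by
    rintro w ⟨f, hf, rfl⟩
    exact (hS f hf).mapsTo h0
  have hK : IsCompact (closure O) := (isCompact_closedBall (0 : ℂ) 1).of_isClosed_subset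
    isClosed_closure (closure_minimal (hOb.trans ball_subset_closedBall) isClosed_closedBall)
  have hτO : τ 0 ∈ closure O := subset_closure ⟨τ, hτ, rfl⟩
  obtain ⟨z₀, hz₀, hmax⟩ := hK.exists_isMaxOn ⟨_, hτO⟩ continuous_norm.continuousOn
  replace hmax : ∀ z ∈ closure O, ‖z‖ ≤ ‖z₀‖ := fun z hz => hmax hz
  by_cases hz1 : 1 ≤ ‖z₀‖
  · obtain ⟨w, hw, f, hf, rfl⟩ := mem_closure_iff.mp hz₀ {w | R < ‖w‖}
      (isOpen_lt continuous_const continuous_norm) (hR.trans_le hz1)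
    exact ⟨f, hf, hw⟩
  exfalso
  push Not at hz1
  have hrot : ∀ w : ℂ, ‖w‖ = 1 → w * z₀ ∈ closure O := by
    intro w hw
    rw [Metric.mem_closure_iff]
    intro ε hε
    obtain ⟨_, ⟨f, hf, rfl⟩, hd⟩ := Metric.mem_closure_iff.mp hz₀ (ε / 2) (by positivity)
    obtain ⟨n, hn⟩ := exists_pow_exp_near hθ hw (ε := ε / 2) (by positivity)
    obtain ⟨f', hf', h⟩ := exists_mem_eqOn_pow_mul hS hg hgu hf n
    refine ⟨_, ⟨f', hf', rfl⟩, ?_⟩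
    rw [h 0 h0, dist_eq_norm]
    rw [dist_eq_norm] at hd
    set v := Complex.exp (2 * (Real.pi : ℂ) * Complex.I * (θ : ℂ)) ^ n
    have hf1 : ‖f 0‖ < 1 := mem_ball_zero_iff.mp ((hS f hf).mapsTo h0)
    calc ‖w * z₀ - v * f 0‖ = ‖w * (z₀ - f 0) - (v - w) * f 0‖ := by ring_nf
      _ ≤ ‖w * (z₀ - f 0)‖ + ‖(v - w) * f 0‖ := norm_sub_le _ _
      _ < ε := by
        rw [norm_mul, norm_mul, hw]
        nlinarith [norm_nonneg (v - w)]
  have hz₀0 : z₀ ≠ 0 := by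
    have := (norm_pos_iff.mpr hτ0).trans_le (hmax _ hτO)
    exact norm_pos_iff.mp this
  obtain ⟨α, β, hαβ, hf⟩ := hS τ hτ
  have hβ : β ≠ 0 := by
    rintro rfl
    exact hτ0 (by rw [hf 0 h0]; simp)
  have hα : α ≠ 0 := norm_pos_iff.mp ((norm_nonneg β).trans_lt hαβ)
  have hnα := norm_ne_zero_iff.mpr hα
  have hnβ := norm_ne_zero_iff.mpr hβ
  have hnz := norm_ne_zero_iff.mpr hz₀0
  have hcα : conj α ≠ 0 := by simpa using hα
  have hcβ : conj β ≠ 0 := by simpa using hβ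
  set w : ℂ := (‖β‖ * ‖z₀‖ * conj α) / (‖α‖ * conj β * z₀) with hw
  have hw1 : ‖w‖ = 1 := by
    simp only [hw, norm_div, norm_mul, Complex.norm_real, norm_norm, RCLike.norm_conj]
    field_simp
  set p := w * z₀ with hp
  have hpn : ‖p‖ = ‖z₀‖ := by rw [hp, norm_mul, hw1, one_mul]
  have hpb : p ∈ ball (0 : ℂ) 1 := by rwa [mem_ball_zero_iff, hpn]
  have hτp : τ p ∈ closure O := by
    refine ((hS τ hτ).continuousAt hpb).continuousWithinAt.mem_closure (hrot w hw1) ?_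
    rintro _ ⟨f, hf, rfl⟩
    exact ⟨τ * f, S.mul_mem hτ hf, rfl⟩
  have hle := hmax _ hτp
  have hden : ‖α‖ ≤ ‖conj β * p + conj α‖ := by
    have : conj β * p + conj α = conj α * ((1 + ‖β‖ * ‖z₀‖ / ‖α‖ : ℝ) : ℂ) := by
      have : (‖α‖ : ℂ) ≠ 0 := by exact_mod_cast hnα
      rw [hp, hw]; push_cast
      field_simp
      ring
    rw [this, norm_mul, RCLike.norm_conj, Complex.norm_real, Real.norm_eq_abs]
    refine le_mul_of_one_le_right (norm_nonneg _) (le_trans ?_ (le_abs_self _))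
    have : 0 ≤ ‖β‖ * ‖z₀‖ / ‖α‖ := by positivity
    linarith
  have hid := disc_norm_identity α β p
  have hdp : 0 < ‖conj β * p + conj α‖ := (norm_pos_iff.mpr hα).trans_le hden
  rw [hf p hpb, norm_div, div_le_iff₀ hdp] at hle
  rw [hpn] at hid
  have h1 : 0 < 1 - ‖z₀‖ ^ 2 := by nlinarith [norm_nonneg z₀]
  have h2 := pow_le_pow_left₀ (norm_nonneg _) hle 2
  have h3 := pow_le_pow_left₀ (norm_nonneg _) hden 2
  have h4 : 0 < ‖β‖ ^ 2 := by positivity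
  rw [mul_pow] at h2
  nlinarith [mul_le_mul_of_nonneg_right h3 h1.le, mul_pos h4 h1]

lemma disc_mobius_sub_apply_zero {α β z : ℂ} (h : ‖β‖ < ‖α‖) (hz : ‖z‖ ≤ 1)
    (hre : -(1 / 2) < (conj β / conj α * z).re) :
    ‖(α * z + β) / (conj β * z + conj α) - β / conj α‖ ≤ 2 * (1 - (‖β‖ / ‖α‖) ^ 2) := by
  have hα : α ≠ 0 := norm_pos_iff.mp ((norm_nonneg β).trans_lt h)
  have hnα := norm_pos_iff.mpr hα
  have hcα : conj α ≠ 0 := by simpa using hα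
  have hd := disc_denom_ne_zero h hz
  have hk : (1 : ℝ) / 2 ≤ ‖1 + conj β / conj α * z‖ := by
    refine le_trans ?_ (Complex.re_le_norm _)
    rw [Complex.add_re, Complex.one_re]
    linarith
  have hdk : conj β * z + conj α = conj α * (1 + conj β / conj α * z) := by
    field_simp
    ring
  have hk0 : 1 + conj β / conj α * z ≠ 0 := fun h0 => hd (by rw [hdk, h0, mul_zero])
  have hD : α * conj α - β * conj β = ((‖α‖ ^ 2 - ‖β‖ ^ 2 : ℝ) : ℂ) := by
    rw [Complex.mul_conj', Complex.mul_conj']; push_cast; rfl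
  have e : (α * z + β) / (conj β * z + conj α) - β / conj α =
      ((‖α‖ ^ 2 - ‖β‖ ^ 2 : ℝ) : ℂ) * z / (conj α * (conj α * (1 + conj β / conj α * z))) := by
    rw [← hdk, ← hD, div_sub_div _ _ hd hcα]
    rw [mul_comm (conj α) (_ + _)]
    congr 1
    ring
  have hD0 : 0 ≤ ‖α‖ ^ 2 - ‖β‖ ^ 2 := by nlinarith [norm_nonneg β]
  rw [e, norm_div, norm_mul, norm_mul, norm_mul, RCLike.norm_conj, Complex.norm_real,
    Real.norm_eq_abs, abs_of_nonneg hD0, div_le_iff₀ (by positivity)]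
  have e2 : 2 * (1 - (‖β‖ / ‖α‖) ^ 2) * (‖α‖ * (‖α‖ * ‖1 + conj β / conj α * z‖)) =
      (‖α‖ ^ 2 - ‖β‖ ^ 2) * (2 * ‖1 + conj β / conj α * z‖) := by
    field_simp
  rw [e2]
  exact mul_le_mul_of_nonneg_left (by linarith) hD0

/-- Under the same hypotheses, `S` contains two maps with disjoint ranges on a common invariant
set, obtained by rotating one map which moves `0` close to the unit circle. -/
lemma exists_pingPong (hS : ∀ f ∈ S, IsDiscAut f) (hθ : Irrational θ) (hg : g ∈ S)
    (hgu : ∀ z ∈ ball (0 : ℂ) 1,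
      g z = Complex.exp (2 * (Real.pi : ℂ) * Complex.I * (θ : ℂ)) * z)
    (hτ : τ ∈ S) (hτ0 : τ 0 ≠ 0) :
    ∃ a ∈ S, ∃ b ∈ S, ∃ X ⊆ ball (0 : ℂ) 1, X.Nonempty ∧ MapsTo a X X ∧ MapsTo b X X ∧
      ∀ x ∈ X, ∀ y ∈ X, a x ≠ b y := by
  have h0 : (0 : ℂ) ∈ ball (0 : ℂ) 1 := by simp
  obtain ⟨f, hf, hR⟩ := exists_mem_lt_norm_apply_zero hS hθ hg hgu hτ hτ0
    (R := 31 / 32) (by norm_num)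
  obtain ⟨α, β, hαβ, hfe⟩ := hS f hf
  rw [hfe 0 h0] at hR
  simp only [mul_zero, zero_add, norm_div, RCLike.norm_conj] at hR
  have hα : α ≠ 0 := norm_pos_iff.mp ((norm_nonneg β).trans_lt hαβ)
  have hnα := norm_pos_iff.mpr hα
  have hr1 : ‖β‖ / ‖α‖ < 1 := (div_lt_one hnα).mpr hαβ
  have key : ∀ s : ℂ, ‖s‖ = 1 → ∃ a ∈ S, ∀ z ∈ ball (0 : ℂ) 1,
      -(1 / 2) < (conj β / conj α * z).re → ‖conj β / conj α * a z - s‖ < 1 / 2 := by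
    intro s hs
    set r := ‖β‖ / ‖α‖ with hr
    set κ := conj β / conj α with hκ
    have hκn : ‖κ‖ = r := by rw [hκ, norm_div, RCLike.norm_conj, RCLike.norm_conj]
    set m := κ * (β / conj α) with hm
    have hmn : ‖m‖ = r ^ 2 := by
      rw [hm, norm_mul, hκn, norm_div, RCLike.norm_conj, sq]
    have hm0 : m ≠ 0 := by
      rw [← norm_pos_iff, hmn]; positivity
    obtain ⟨n, hn⟩ := exists_pow_exp_near hθ (w := s * (r ^ 2 : ℝ) / m)
      (by rw [norm_div, norm_mul, hmn, Complex.norm_real, hs, Real.norm_eq_abs, abs_sq, one_mul,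
            div_self (by positivity)])
      (ε := 1 / 8) (by norm_num)
    obtain ⟨a, ha, hae⟩ := exists_mem_eqOn_pow_mul hS hg hgu hf n
    refine ⟨a, ha, fun z hz hre => ?_⟩
    have hfz := disc_mobius_sub_apply_zero hαβ (mem_ball_zero_iff.mp hz).le hre
    rw [← hr, ← hfe z hz] at hfz
    set v := Complex.exp (2 * (Real.pi : ℂ) * Complex.I * (θ : ℂ)) ^ n with hv
    have hvn : ‖v‖ = 1 := by rw [hv, norm_pow, norm_exp_two_pi_I_mul, one_pow]
    have e : κ * a z - s = κ * v * (f z - β / conj α) + (v - s * (r ^ 2 : ℝ) / m) * m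
        + s * ((r ^ 2 - 1 : ℝ) : ℂ) := by
      rw [hae z hz, sub_mul, div_mul_cancel₀ _ hm0, hm]
      push_cast
      ring
    have n1 : ‖κ * v * (f z - β / conj α)‖ ≤ 1 * (2 * (1 - r ^ 2)) := by
      rw [norm_mul, norm_mul, hκn, hvn, mul_one]
      exact mul_le_mul hr1.le hfz (norm_nonneg _) zero_le_one
    have n2 : ‖(v - s * (r ^ 2 : ℝ) / m) * m‖ ≤ 1 / 8 * 1 := by
      rw [norm_mul, hmn]
      exact mul_le_mul hn.le (by nlinarith) (by positivity) (by norm_num)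
    have n3 : ‖s * ((r ^ 2 - 1 : ℝ) : ℂ)‖ ≤ 1 - r ^ 2 := by
      rw [norm_mul, hs, Complex.norm_real, Real.norm_eq_abs, abs_of_nonpos (by nlinarith)]
      linarith
    rw [e]
    refine (norm_add₃_le).trans_lt ?_
    nlinarith
  obtain ⟨a, ha, hae⟩ := key Complex.I (by simp)
  obtain ⟨b, hb, hbe⟩ := key (-Complex.I) (by simp)
  refine ⟨a, ha, b, hb, {z | z ∈ ball (0 : ℂ) 1 ∧ -(1 / 2) < (conj β / conj α * z).re},
    fun z hz => hz.1, ⟨0, h0, by norm_num⟩, fun z hz => ⟨(hS a ha).mapsTo hz.1, ?_⟩,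
    fun z hz => ⟨(hS b hb).mapsTo hz.1, ?_⟩, fun x hx y hy hxy => ?_⟩
  · have h := (Complex.abs_re_le_norm _).trans_lt (hae z hz.1 hz.2)
    rw [Complex.sub_re, Complex.I_re, sub_zero, abs_lt] at h
    exact h.1
  · have h := (Complex.abs_re_le_norm _).trans_lt (hbe z hz.1 hz.2)
    rw [Complex.sub_re, Complex.neg_re, Complex.I_re, neg_zero, sub_zero, abs_lt] at h
    exact h.1
  · have h := (Complex.abs_im_le_norm _).trans_lt (hae x hx.1 hx.2)
    have h' := (Complex.abs_im_le_norm _).trans_lt (hbe y hy.1 hy.2)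
    rw [Complex.sub_im, Complex.I_im, hxy, abs_lt] at h
    rw [Complex.sub_im, Complex.neg_im, Complex.I_im, abs_lt] at h'
    linarith [h.1, h'.2]

end RotationAndTransvection

/-- Ping-pong lemma for semigroups of self-maps that are injective on `D`. -/
lemma list_eq_of_pingPong {D X : Set ℂ} (hX : X ⊆ D) (hXne : X.Nonempty)
    {F : Bool → Function.End ℂ} (hD : ∀ i, MapsTo (F i) D D) (hinj : ∀ i, InjOn (F i) D)
    (hFX : ∀ i, MapsTo (F i) X X)
    (hdisj : ∀ i j, i ≠ j → ∀ x ∈ X, ∀ y ∈ X, F i x ≠ F j y) (l l' : List Bool)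
    (h : EqOn ((l.map F).prod : Function.End ℂ) ((l'.map F).prod : Function.End ℂ) D) :
    l = l' := by
  have hprodX : ∀ l : List Bool, MapsTo ((l.map F).prod : Function.End ℂ) X X := by
    intro l
    induction l with
    | nil => exact mapsTo_id X
    | cons i l ih => exact (hFX i).comp ih
  have hprodD : ∀ l : List Bool, MapsTo ((l.map F).prod : Function.End ℂ) D D := by
    intro l
    induction l with
    | nil => exact mapsTo_id D
    | cons i l ih => exact (hD i).comp ih
  have hne : ∀ (i : Bool) (l : List Bool),
      ¬ EqOn (((i :: l).map F).prod : Function.End ℂ) id D := by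
    intro i l h
    obtain ⟨x, hx⟩ := hXne
    have hy := hFX (!i) hx
    exact hdisj i (!i) (by simp) _ (hprodX l hy) x hx (h (hX hy))
  induction l generalizing l' with
  | nil =>
    cases l' with
    | nil => rfl
    | cons j l' => exact (hne j l' h.symm).elim
  | cons i l ih =>
    cases l' with
    | nil => exact (hne i l h).elim
    | cons j l' =>
      by_cases hij : i = j
      · subst hij
        rw [ih l' fun z hz => hinj i (hprodD l hz) (hprodD l' hz) (h hz)]
      · obtain ⟨x, hx⟩ := hXne
        exact (hdisj i j hij _ (hprodX l hx) _ (hprodX l' hx) (h (hX hx))).elim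

lemma freeSemigroup_lift_eq_prod {α M : Type*} [Monoid M] (F : α → M) (w : FreeSemigroup α) :
    FreeSemigroup.lift F w = ((w.head :: w.tail).map F).prod := by
  induction w using FreeSemigroup.recOnMul with
  | ih1 x => simp [FreeSemigroup.of, FreeSemigroup.lift_mk_eq_foldl]
  | ih2 x y hx hy =>
    rw [map_mul, hx, hy]
    simp [FreeSemigroup.head_mul, FreeSemigroup.tail_mul]

lemma exists_eqOn_of_mem_closure_same_center {c : ℂ} (hc : ‖c‖ < 1) (θ₁ θ₂ : ℝ)
    {f : Function.End ℂ}
    (hf : f ∈ (Subsemigroup.closure {(discRotation c θ₁ : Function.End ℂ),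
      (discRotation c θ₂ : Function.End ℂ)} : Subsemigroup (Function.End ℂ))) :
    ∃ u : ℂ, ‖u‖ = 1 ∧ EqOn f (fun z => discMobiusInv c (u * discMobius c z)) (ball 0 1) := by
  induction hf using Subsemigroup.closure_induction with
  | mem f hf =>
    rcases hf with rfl | rfl
    · exact ⟨_, norm_exp_two_pi_I_mul θ₁, fun z _ => rfl⟩
    · exact ⟨_, norm_exp_two_pi_I_mul θ₂, fun z _ => rfl⟩
  | mul f g _ _ hf hg =>
    obtain ⟨u, hu, hf⟩ := hf
    obtain ⟨v, hv, hg⟩ := hg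
    refine ⟨u * v, by rw [norm_mul, hu, hv, one_mul], fun z hz => ?_⟩
    have hv' := (isDiscAut_mul_left hv).mapsTo ((isDiscAut_discMobius hc).mapsTo hz)
    change f (g z) = _
    rw [hg hz]
    dsimp only at hv' ⊢
    rw [hf ((isDiscAut_discMobiusInv hc).mapsTo hv')]
    dsimp only
    rw [discMobius_discMobiusInv hc hv', mul_assoc]

lemma discRotation_apply_ne_self {c z : ℂ} (hc : ‖c‖ < 1) (hz : z ∈ ball (0 : ℂ) 1)
    (hcz : z ≠ c) {θ : ℝ} (hθ : Irrational θ) : discRotation c θ z ≠ z := by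
  intro h
  have hm := (isDiscAut_discMobius hc).mapsTo hz
  have hu := (isDiscAut_mul_left (norm_exp_two_pi_I_mul θ)).mapsTo hm
  have h1 := congrArg (discMobius c) h
  rw [discRotation, discMobius_discMobiusInv hc hu] at h1
  have h2 : discMobius c z ≠ 0 := by
    intro h0
    refine hcz ((isDiscAut_discMobius hc).injOn hz (mem_ball_zero_iff.mpr hc) ?_)
    rw [h0]; simp [discMobius]
  have h3 := (mul_eq_right₀ h2).mp h1
  obtain ⟨n, hn⟩ := Complex.exp_eq_one_iff.mp h3
  have h4 : (θ : ℂ) = n := by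
    have : (2 * (Real.pi : ℂ) * Complex.I) ≠ 0 := Complex.two_pi_I_ne_zero
    apply mul_left_cancel₀ this
    rw [hn]; ring
  exact hθ.ne_int n (by exact_mod_cast h4)

end DiscAut

/-- Two irrational rotations of the unit disc either have the same
centre, in which case they generate an abelian semigroup of self-maps of the disc, or have
different centres, in which case the semigroup they generate contains a non-cyclic free
subsemigroup (of self-maps of the disc). -/
theorem disc_rotations_alternative (c₁ c₂ : ℂ) (hc₁ : ‖c₁‖ < 1) (hc₂ : ‖c₂‖ < 1)
    (θ₁ θ₂ : ℝ) (hθ₁ : Irrational θ₁) (hθ₂ : Irrational θ₂) :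
    (c₁ = c₂ →
      ∀ a ∈ (Subsemigroup.closure {(discRotation c₁ θ₁ : Function.End ℂ),
          (discRotation c₂ θ₂ : Function.End ℂ)} : Subsemigroup (Function.End ℂ)),
      ∀ b ∈ (Subsemigroup.closure {(discRotation c₁ θ₁ : Function.End ℂ),
          (discRotation c₂ θ₂ : Function.End ℂ)} : Subsemigroup (Function.End ℂ)),
        Set.EqOn ((a : ℂ → ℂ) ∘ (b : ℂ → ℂ)) ((b : ℂ → ℂ) ∘ (a : ℂ → ℂ))
          (Metric.ball (0 : ℂ) 1)) ∧
    (c₁ ≠ c₂ →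
      ∃ a ∈ (Subsemigroup.closure {(discRotation c₁ θ₁ : Function.End ℂ),
          (discRotation c₂ θ₂ : Function.End ℂ)} : Subsemigroup (Function.End ℂ)),
      ∃ b ∈ (Subsemigroup.closure {(discRotation c₁ θ₁ : Function.End ℂ),
          (discRotation c₂ θ₂ : Function.End ℂ)} : Subsemigroup (Function.End ℂ)),
        Function.Injective (fun w : FreeSemigroup Bool =>
          (Metric.ball (0 : ℂ) 1).restrict
            (((FreeSemigroup.lift (fun x : Bool => if x then a else b) :
              FreeSemigroup Bool →ₙ* Function.End ℂ) w : ℂ → ℂ)))) := by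
  constructor
  · rintro rfl a ha b hb z hz
    obtain ⟨u, hu, hau⟩ := exists_eqOn_of_mem_closure_same_center hc₁ θ₁ θ₂ ha
    obtain ⟨v, hv, hbv⟩ := exists_eqOn_of_mem_closure_same_center hc₁ θ₁ θ₂ hb
    have hm := (isDiscAut_discMobius hc₁).mapsTo hz
    have hum := (isDiscAut_mul_left hu).mapsTo hm
    have hvm := (isDiscAut_mul_left hv).mapsTo hm
    change a (b z) = b (a z)
    rw [hau hz, hbv hz,
      hau ((isDiscAut_discMobiusInv hc₁).mapsTo hvm),
      hbv ((isDiscAut_discMobiusInv hc₁).mapsTo hum)]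
    beta_reduce
    rw [discMobius_discMobiusInv hc₁ hvm, discMobius_discMobiusInv hc₁ hum, mul_left_comm]
  · intro hne
    set Γ := (Subsemigroup.closure {(discRotation c₁ θ₁ : Function.End ℂ),
      (discRotation c₂ θ₂ : Function.End ℂ)} : Subsemigroup (Function.End ℂ))
    have hφ := isDiscAut_discMobius hc₁
    have hψ := isDiscAut_discMobiusInv hc₁
    have hγΓ : (discRotation c₁ θ₁ : Function.End ℂ) ∈ Γ :=
      Subsemigroup.subset_closure (Set.mem_insert _ _)
    have hτΓ : (discRotation c₂ θ₂ : Function.End ℂ) ∈ Γ :=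
      Subsemigroup.subset_closure (Set.mem_insert_of_mem _ rfl)
    have hΓaut : ∀ f ∈ Γ, IsDiscAut f := by
      intro f hf
      induction hf using Subsemigroup.closure_induction with
      | mem f hf =>
        rcases hf with rfl | rfl
        · exact isDiscAut_discRotation hc₁ θ₁
        · exact isDiscAut_discRotation hc₂ θ₂
      | mul f g _ _ hf hg => exact hf.comp hg
    let S : Subsemigroup (Function.End ℂ) :=
      { carrier := {f | IsDiscAut f ∧ ∃ a ∈ Γ,
          ∀ z ∈ Metric.ball (0 : ℂ) 1, f z = discMobius c₁ (a (discMobiusInv c₁ z))}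
        mul_mem' := by
          rintro f g ⟨hf, a, ha, hfa⟩ ⟨hg, b, hb, hgb⟩
          refine ⟨hf.comp hg, a * b, Γ.mul_mem ha hb, fun z hz => ?_⟩
          change f (g z) = discMobius c₁ (a (b (discMobiusInv c₁ z)))
          rw [hfa _ (hg.mapsTo hz), hgb z hz,
            discMobiusInv_discMobius hc₁ ((hΓaut b hb).mapsTo (hψ.mapsTo hz))] }
    have hconj : ∀ a ∈ Γ,
        ((discMobius c₁ ∘ (a : ℂ → ℂ) ∘ discMobiusInv c₁ : ℂ → ℂ) : Function.End ℂ) ∈ S :=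
      fun a ha => ⟨hφ.comp ((hΓaut a ha).comp hψ), a, ha, fun z _ => rfl⟩
    have hψ0 : discMobiusInv c₁ 0 = c₁ := by simp [discMobiusInv]
    have hc₁b : c₁ ∈ Metric.ball (0 : ℂ) 1 := mem_ball_zero_iff.mpr hc₁
    obtain ⟨a', ⟨-, a, ha, hae⟩, b', ⟨-, b, hb, hbe⟩, X, hXb, hXne, haX, hbX, hdisj⟩ :=
      exists_pingPong (S := S) (fun f hf => hf.1) hθ₁ (hconj _ hγΓ)
        (fun z hz => by
          have h1 := (isDiscAut_mul_left (norm_exp_two_pi_I_mul θ₁)).mapsTo hz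
          change discMobius c₁ (discRotation c₁ θ₁ (discMobiusInv c₁ z)) = _
          rw [discRotation, discMobius_discMobiusInv hc₁ hz, discMobius_discMobiusInv hc₁ h1])
        (hconj _ hτΓ)
        (fun h => by
          change discMobius c₁ (discRotation c₂ θ₂ (discMobiusInv c₁ 0)) = 0 at h
          rw [hψ0] at h
          refine discRotation_apply_ne_self hc₂ hc₁b hne hθ₂
            (hφ.injOn ((isDiscAut_discRotation hc₂ θ₂).mapsTo hc₁b) hc₁b ?_)
          rw [h]; simp [discMobius])
    have hback : ∀ {f g : Function.End ℂ}, f ∈ Γ →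
        (∀ z ∈ Metric.ball (0 : ℂ) 1, g z = discMobius c₁ (f (discMobiusInv c₁ z))) →
        ∀ z ∈ X, f (discMobiusInv c₁ z) = discMobiusInv c₁ (g z) := by
      intro f g hf h z hz
      rw [h z (hXb hz),
        discMobiusInv_discMobius hc₁ ((hΓaut f hf).mapsTo (hψ.mapsTo (hXb hz)))]
    have hab : ∀ x ∈ X, ∀ y ∈ X, a (discMobiusInv c₁ x) ≠ b (discMobiusInv c₁ y) := by
      intro x hx y hy h
      rw [hback ha hae x hx, hback hb hbe y hy] at h
      exact hdisj x hx y hy (hψ.injOn (hXb (haX hx)) (hXb (hbX hy)) h)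
    have hmem : ∀ i : Bool, (if i then a else b) ∈ Γ := by
      rintro (_ | _)
      exacts [hb, ha]
    refine ⟨a, ha, b, hb, fun w w' h => ?_⟩
    have hlist := list_eq_of_pingPong (D := Metric.ball (0 : ℂ) 1) (X := discMobiusInv c₁ '' X)
      (F := fun x : Bool => if x then a else b)
      (Set.image_subset_iff.mpr fun z hz => hψ.mapsTo (hXb hz)) (hXne.image _)
      (fun i => (hΓaut _ (hmem i)).mapsTo) (fun i => (hΓaut _ (hmem i)).injOn)
      (by
        rintro (_ | _) _ ⟨x, hx, rfl⟩
        · exact ⟨b' x, hbX hx, (hback hb hbe x hx).symm⟩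
        · exact ⟨a' x, haX hx, (hback ha hae x hx).symm⟩)
      (by
        rintro (_ | _) (_ | _) hij _ ⟨x, hx, rfl⟩ _ ⟨y, hy, rfl⟩
        · exact (hij rfl).elim
        · exact (hab y hy x hx).symm
        · exact hab x hx y hy
        · exact (hij rfl).elim)
      (w.head :: w.tail) (w'.head :: w'.tail)
      (by
        rw [← freeSemigroup_lift_eq_prod, ← freeSemigroup_lift_eq_prod]
        exact Set.domRestrict_eq_domRestrict_iff.mp h)
    rw [List.cons.injEq] at hlist
    exact FreeSemigroup.ext hlist.1 hlist.2

end
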